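/- Every Mogami d-pseudomanifold is simply connected. -/

import Mathlib

open Finset

namespace MogamiPaper

/-- A configuration of `N` labelled `d`-simplices with vertices in `V`:
facet `i` has vertex list `f i`. Vertex identifications (gluings) are recorded
by the labelling map. -/
abbrev Config (V : Type*) (d N : ℕ) := Fin N → Fin (d + 1) → V

variable {V : Type*} [DecidableEq V] {d N : ℕ}

/-- the vertex set of the `i`-th facet -/
def facet (f : Config V d N) (i : Fin N) : Finset V :=
  Finset.image (f i) Finset.univ

/-- each facet has `d+1` distinct vertices -/
def Proper (f : Config V d N) : Prop := ∀ i, Function.Injective (f i)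

/-- the facets containing a given set of vertices -/
def cells (f : Config V d N) (R : Finset V) : Finset (Fin N) :=
  Finset.univ.filter fun i => R ⊆ facet f i

/-- pseudomanifold: proper, and every `(d-1)`-face lies in at most two facets -/
def IsPseudo (f : Config V d N) : Prop :=
  Proper f ∧ ∀ R : Finset V, R.card = d → (cells f R).card ≤ 2

/-- a boundary `(d-1)`-face: contained in exactly one facet -/
def IsBdryRidge (f : Config V d N) (R : Finset V) : Prop :=
  R.card = d ∧ (cells f R).card = 1

/-- A gluing step: identify two distinct boundary `(d-1)`-faces `R`, `S`, whose
intersection cardinality satisfies `P`, via a vertex identification `φ` that maps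
`R` bijectively onto `S` and fixes everything outside `R`. -/
def Step (P : ℕ → Prop) (f g : Config V d N) : Prop :=
  ∃ R S : Finset V, IsBdryRidge f R ∧ IsBdryRidge f S ∧ R ≠ S ∧ P ((R ∩ S).card) ∧
    ∃ φ : V → V, (∀ v, v ∉ R → φ v = v) ∧ Set.InjOn φ ↑R ∧ R.image φ = S ∧
      ∀ i j, g i j = φ (f i j)

/-- Mogami gluing: the glued boundary facets share at least a vertex -/
def MogamiStep (f g : Config V d N) : Prop := Step (fun c => 1 ≤ c) f g

/-- LC gluing: the glued boundary facets share a `(d-2)`-face -/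
def LCStep (f g : Config V d N) : Prop := Step (fun c => c = d - 1) f g

/-- the dual graph: two facets are adjacent if they share a `(d-1)`-face -/
def dualGraph (f : Config V d N) : SimpleGraph (Fin N) :=
  SimpleGraph.fromRel fun i i' =>
    ∃ R : Finset V, R.card = d ∧ R ⊆ facet f i ∧ R ⊆ facet f i'

/-- UNITE: glue two disjoint boundary facets belonging to (dually) disconnected parts -/
def UniteStep (f g : Config V d N) : Prop :=
  ∃ R S : Finset V, IsBdryRidge f R ∧ IsBdryRidge f S ∧ Disjoint R S ∧
    (∀ i ∈ cells f R, ∀ i' ∈ cells f S, ¬ (dualGraph f).Reachable i i') ∧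
    ∃ φ : V → V, (∀ v, v ∉ R → φ v = v) ∧ Set.InjOn φ ↑R ∧ R.image φ = S ∧
      ∀ i j, g i j = φ (f i j)

/-- the canonical configuration of `N` pairwise disjoint `d`-simplices -/
def std (d N : ℕ) : Config (Fin N × Fin (d + 1)) d N := fun i j => (i, j)

/-- a tree of `d`-simplices (over the canonical vertex pool): obtained from `N`
disjoint simplices by UNITE steps, with connected (hence tree) dual graph -/
def IsTreeOfSimplicesC (t : Config (Fin N × Fin (d + 1)) d N) : Prop :=
  Relation.ReflTransGen UniteStep (std d N) t ∧ (dualGraph t).Connected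

/-- `g` represents `f` up to an injective relabeling of the used vertices -/
def Represents (g : Config (Fin N × Fin (d + 1)) d N) (f : Config V d N) : Prop :=
  ∃ e : Fin N × Fin (d + 1) → V,
    Set.InjOn e {x | ∃ i j, g i j = x} ∧ ∀ i j, f i j = e (g i j)

/-- Mogami: obtainable from a tree of `d`-simplices by Mogami gluings -/
def IsMogami (f : Config V d N) : Prop :=
  ∃ t g : Config (Fin N × Fin (d + 1)) d N,
    IsTreeOfSimplicesC t ∧ Relation.ReflTransGen MogamiStep t g ∧ Represents g f

/-- locally constructible: obtainable from a tree of `d`-simplices by LC gluings -/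
def IsLC (f : Config V d N) : Prop :=
  ∃ t g : Config (Fin N × Fin (d + 1)) d N,
    IsTreeOfSimplicesC t ∧ Relation.ReflTransGen LCStep t g ∧ Represents g f

/-- the geometric realization, as a subspace of `V → ℝ` -/
def realization [Fintype V] (f : Config V d N) : Set (V → ℝ) :=
  {x | (∀ v, 0 ≤ x v) ∧ (∑ v, x v) = 1 ∧ ∃ i : Fin N, ∀ v, x v ≠ 0 → v ∈ facet f i}

/-- a triangulated `d`-ball: realization homeomorphic to the unit ball of `ℝ^d` -/
def IsBall [Fintype V] (f : Config V d N) : Prop :=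
  Nonempty ((realization f) ≃ₜ
    (Metric.closedBall (0 : EuclideanSpace ℝ (Fin d)) 1 : Set (EuclideanSpace ℝ (Fin d))))

/-- all vertices lie on the boundary -/
def NoInteriorVertices (f : Config V d N) : Prop :=
  ∀ i j, ∃ R : Finset V, IsBdryRidge f R ∧ f i j ∈ R

/-- the cone over a configuration, with apex `v` -/
def cone (f : Config V d N) (v : V) : Config V (d + 1) N :=
  fun i => Fin.cons v (f i)

end MogamiPaper

namespace MogamiPaper

/-! ### Cocycles on configurations -/

/-- Every group-valued `1`-cocycle on the complex of `f` is a coboundary. -/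
def CocyclesTrivial.{u, w} {V : Type u} {d N : ℕ} (f : Config V d N) : Prop :=
  ∀ (G : Type w) [Group G] (c : V → V → G),
    (∀ i j k l, c (f i j) (f i k) * c (f i k) (f i l) = c (f i j) (f i l)) →
      ∃ h : V → G, ∀ i j k, c (f i j) (f i k) = (h (f i j))⁻¹ * h (f i k)

/-- Two facets share a vertex. -/
def Touch {V : Type*} {d N : ℕ} (f : Config V d N) (i i' : Fin N) : Prop :=
  ∃ j j', f i j = f i' j'

section

variable {V : Type*} [DecidableEq V] {d N : ℕ}

theorem mem_facet {f : Config V d N} {i : Fin N} {v : V} :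
    v ∈ facet f i ↔ ∃ j, f i j = v := by
  simp [facet]

theorem IsBdryRidge.exists_subset_facet {f : Config V d N} {R : Finset V}
    (hR : IsBdryRidge f R) : ∃ i ∈ cells f R, R ⊆ facet f i := by
  obtain ⟨i, hi⟩ := Finset.card_pos.mp (hR.2.symm ▸ Nat.one_pos)
  exact ⟨i, hi, (Finset.mem_filter.mp hi).2⟩

/-- A function on the corners of the simplices that is constant on the fibers of `g` descends to
the vertices of `g`. -/
theorem exists_descent {V G : Type*} [One G] {d N : ℕ} (g : Config V d N)
    (a : Fin N → Fin (d + 1) → G)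
    (ha : ∀ i j i' j', g i j = g i' j' → a i j = a i' j') :
    ∃ h : V → G, ∀ i j, h (g i j) = a i j := by
  have hf : Function.FactorsThrough (fun p : Fin N × Fin (d + 1) => a p.1 p.2)
      (fun p : Fin N × Fin (d + 1) => g p.1 p.2) := fun p q h => ha _ _ _ _ h
  exact ⟨Function.extend (fun p : Fin N × Fin (d + 1) => g p.1 p.2) (fun p => a p.1 p.2) 1,
    fun i j => hf.extend_apply 1 (i, j)⟩

/-- Triviality of cocycles passes to a quotient as soon as potentials can be chosen to be
constant on the fibers of the vertex identification. -/
theorem CocyclesTrivial.of_map.{u, u', w} {V : Type u} {W : Type u'} {d N : ℕ}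
    {f : Config V d N} {g : Config W d N} (hf : CocyclesTrivial.{u, w} f) (φ : V → W)
    (hg : ∀ i j, g i j = φ (f i j))
    (H : ∀ (G : Type w) [Group G] (c : W → W → G) (h : V → G),
      (∀ i j k, c (φ (f i j)) (φ (f i k)) = (h (f i j))⁻¹ * h (f i k)) →
      ∃ h' : V → G, (∀ i j k, c (φ (f i j)) (φ (f i k)) = (h' (f i j))⁻¹ * h' (f i k)) ∧
        ∀ i j i' j', φ (f i j) = φ (f i' j') → h' (f i j) = h' (f i' j')) :
    CocyclesTrivial.{u', w} g := by
  intro G _ c hc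
  obtain ⟨h, hh⟩ := hf G (fun u v => c (φ u) (φ v)) (fun i j k l => by
    simpa only [hg] using hc i j k l)
  obtain ⟨h', hh', hfib⟩ := H G c h hh
  obtain ⟨k, hk⟩ := exists_descent g (fun i j => h' (f i j)) (fun i j i' j' e =>
    hfib i j i' j' (by rw [← hg, ← hg, e]))
  refine ⟨k, fun i j l => ?_⟩
  rw [hk, hk, hg, hg, hh']

/-- Vertices of `R` and `S` identified by `φ` are the only distinct vertices that get identified. -/
theorem eq_or_mem_of_map_eq {φ : V → V} {R S : Finset V} (hφ : ∀ v, v ∉ R → φ v = v)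
    (hinj : Set.InjOn φ ↑R) (hRS : R.image φ = S) {u v : V} (h : φ u = φ v) :
    u = v ∨ (u ∈ R ∧ v ∈ S) ∨ (v ∈ R ∧ u ∈ S) := by
  by_cases hu : u ∈ R <;> by_cases hv : v ∈ R
  · exact Or.inl (hinj hu hv h)
  · refine Or.inr (Or.inl ⟨hu, ?_⟩)
    rw [← hRS, ← hφ v hv, ← h]
    exact Finset.mem_image_of_mem φ hu
  · refine Or.inr (Or.inr ⟨hv, ?_⟩)
    rw [← hRS, ← hφ u hu, h]
    exact Finset.mem_image_of_mem φ hv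
  · exact Or.inl (by rw [← hφ u hu, h, hφ v hv])

theorem coboundary_of_mem_facet {W G : Type*} [Group G] {f : Config V d N} {φ : V → W}
    {c : W → W → G} {h : V → G}
    (hc : ∀ i j k, c (φ (f i j)) (φ (f i k)) = (h (f i j))⁻¹ * h (f i k))
    {i : Fin N} {u v : V} (hu : u ∈ facet f i) (hv : v ∈ facet f i) :
    c (φ u) (φ v) = (h u)⁻¹ * h v := by
  obtain ⟨j, rfl⟩ := mem_facet.mp hu
  obtain ⟨k, rfl⟩ := mem_facet.mp hv
  exact hc i j k

theorem MogamiStep.cocyclesTrivial.{u, w} {V : Type u} [DecidableEq V] {d N : ℕ}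
    {f g : Config V d N} (hs : MogamiStep f g) (hf : CocyclesTrivial.{u, w} f) :
    CocyclesTrivial.{u, w} g := by
  obtain ⟨R, S, hR, hS, -, hcap, φ, hφ, hinj, hRS, hg⟩ := hs
  obtain ⟨i₀, -, hi₀⟩ := hR.exists_subset_facet
  obtain ⟨i₁, -, hi₁⟩ := hS.exists_subset_facet
  obtain ⟨w, hw⟩ := Finset.card_pos.mp hcap
  obtain ⟨hwR, hwS⟩ := Finset.mem_inter.mp hw
  refine hf.of_map φ hg fun G _ c h hh => ⟨h, hh, fun i j i' j' e => ?_⟩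
  have key : ∀ u ∈ R, ∀ v ∈ S, φ u = φ v → h u = h v := fun u hu v hv huv => by
    have h₀ := coboundary_of_mem_facet hh (hi₀ hu) (hi₀ hwR)
    rw [huv, coboundary_of_mem_facet hh (hi₁ hv) (hi₁ hwS)] at h₀
    exact (inv_injective (mul_right_cancel h₀)).symm
  rcases eq_or_mem_of_map_eq hφ hinj hRS e with e' | ⟨hu, hv⟩ | ⟨hv, hu⟩
  · rw [e']
  · exact key _ hu _ hv e
  · exact (key _ hv _ hu e.symm).symm

theorem std_cocyclesTrivial.{w} (d N : ℕ) : CocyclesTrivial.{0, w} (std d N) := by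
  intro G _ c hc
  refine ⟨fun p => c (p.1, 0) p, fun i j k => ?_⟩
  rw [eq_inv_mul_iff_mul_eq]
  exact hc i 0 j k

theorem Represents.cocyclesTrivial.{u, w} {V : Type u} {d N : ℕ}
    {g : Config (Fin N × Fin (d + 1)) d N} {f : Config V d N} (hr : Represents g f)
    (hg : CocyclesTrivial.{0, w} g) : CocyclesTrivial.{u, w} f := by
  obtain ⟨e, he, hf⟩ := hr
  refine hg.of_map e hf fun G _ c h hh => ⟨h, hh, fun i j i' j' hij => ?_⟩
  rw [he ⟨_, _, rfl⟩ ⟨_, _, rfl⟩ hij]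

/-! ### Properness and connectedness -/

theorem Proper.of_map {V W : Type*} {d N : ℕ} {f : Config V d N} {g : Config W d N} {φ : V → W}
    (hp : Proper g) (hg : ∀ i j, g i j = φ (f i j)) : Proper f := fun i j k h =>
  hp i (by rw [hg, hg, h])

theorem Proper.of_mogamiSteps {f g : Config V d N} (hs : Relation.ReflTransGen MogamiStep f g)
    (hp : Proper g) : Proper f := by
  induction hs with
  | refl => exact hp
  | tail _ hs ih =>
    obtain ⟨-, -, -, -, -, -, φ, -, -, -, hg⟩ := hs
    exact ih (hp.of_map hg)

theorem Touch.map {V W : Type*} {f : Config V d N} {g : Config W d N} {φ : V → W}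
    (hg : ∀ i j, g i j = φ (f i j)) {i i' : Fin N} (h : Touch f i i') : Touch g i i' := by
  obtain ⟨j, j', h⟩ := h
  exact ⟨j, j', by rw [hg, hg, h]⟩

theorem facet_map {W : Type*} [DecidableEq W] {f : Config V d N} {g : Config W d N} {φ : V → W}
    (hg : ∀ i j, g i j = φ (f i j)) (i : Fin N) : facet g i = (facet f i).image φ := by
  ext v
  simp [facet, hg]

theorem injOn_facet {W : Type*} {f : Config V d N} {g : Config W d N} {φ : V → W}
    (hg : ∀ i j, g i j = φ (f i j)) (hp : Proper g) (i : Fin N) :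
    Set.InjOn φ ↑(facet f i) := by
  intro u hu v hv h
  obtain ⟨j, rfl⟩ := mem_facet.mp hu
  obtain ⟨k, rfl⟩ := mem_facet.mp hv
  rw [hp i ((hg i j).trans (h.trans (hg i k).symm))]

theorem dualGraph_reachable {f : Config V d N} {i i' : Fin N} {R : Finset V} (hR : R.card = d)
    (hi : R ⊆ facet f i) (hi' : R ⊆ facet f i') : (dualGraph f).Reachable i i' := by
  by_cases h : i = i'
  · exact h ▸ SimpleGraph.Reachable.refl i
  · refine SimpleGraph.Adj.reachable ?_
    rw [dualGraph, SimpleGraph.fromRel_adj]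
    exact ⟨h, Or.inl ⟨R, hR, hi, hi'⟩⟩

theorem dualGraph_adj {f : Config V d N} {i i' : Fin N} (h : (dualGraph f).Adj i i') :
    ∃ R : Finset V, R.card = d ∧ R ⊆ facet f i ∧ R ⊆ facet f i' := by
  rw [dualGraph, SimpleGraph.fromRel_adj] at h
  rcases h.2 with ⟨R, hR, h₁, h₂⟩ | ⟨R, hR, h₁, h₂⟩
  exacts [⟨R, hR, h₁, h₂⟩, ⟨R, hR, h₂, h₁⟩]

theorem reachable_map {W : Type*} [DecidableEq W] {f : Config V d N} {g : Config W d N}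
    {φ : V → W} (hg : ∀ i j, g i j = φ (f i j)) (hp : Proper g) {i i' : Fin N}
    (h : (dualGraph f).Reachable i i') : (dualGraph g).Reachable i i' := by
  rw [SimpleGraph.reachable_iff_reflTransGen] at h
  induction h with
  | refl => exact SimpleGraph.Reachable.refl _
  | tail _ hadj ih =>
    obtain ⟨R, hR, h₁, h₂⟩ := dualGraph_adj hadj
    refine ih.trans (dualGraph_reachable (R := R.image φ) ?_ ?_ ?_)
    · rw [Finset.card_image_of_injOn ((injOn_facet hg hp _).mono (Finset.coe_subset.mpr h₁)), hR]
    · rw [facet_map hg]; exact Finset.image_subset_image h₁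
    · rw [facet_map hg]; exact Finset.image_subset_image h₂

theorem UniteStep.reachable_of_touch {f g : Config V d N} (hs : UniteStep f g) (hp : Proper g)
    (hf : ∀ i i', Touch f i i' → (dualGraph f).Reachable i i') {i i' : Fin N}
    (h : Touch g i i') : (dualGraph g).Reachable i i' := by
  obtain ⟨R, S, hR, hS, hdisj, -, φ, hφ, hinj, hRS, hg⟩ := hs
  obtain ⟨i₀, -, hi₀⟩ := hR.exists_subset_facet
  obtain ⟨i₁, -, hi₁⟩ := hS.exists_subset_facet
  have hSφ : S.image φ = S := by
    refine (Finset.image_congr fun v hv => ?_).trans Finset.image_id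
    exact hφ v (Finset.disjoint_right.mp hdisj hv)
  have h₀₁ : (dualGraph g).Reachable i₀ i₁ := by
    refine dualGraph_reachable hS.1 ?_ ?_
    · rw [facet_map hg, ← hRS]; exact Finset.image_subset_image hi₀
    · rw [facet_map hg, ← hSφ]; exact Finset.image_subset_image hi₁
  have key : ∀ k l : Fin N, ∀ j j', f k j ∈ R → f l j' ∈ S → (dualGraph g).Reachable k l := by
    intro k l j j' hu hv
    obtain ⟨a, ha⟩ := mem_facet.mp (hi₀ hu)
    obtain ⟨b, hb⟩ := mem_facet.mp (hi₁ hv)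
    exact ((reachable_map hg hp (hf k i₀ ⟨j, a, ha.symm⟩)).trans h₀₁).trans
      (reachable_map hg hp (hf i₁ l ⟨b, j', hb⟩))
  obtain ⟨j, j', e⟩ := h
  rw [hg, hg] at e
  rcases eq_or_mem_of_map_eq hφ hinj hRS e with e' | ⟨hu, hv⟩ | ⟨hv, hu⟩
  · exact reachable_map hg hp (hf i i' ⟨j, j', e'⟩)
  · exact key i i' j j' hu hv
  · exact (key i' i j' j hv hu).symm

theorem UniteStep.cocyclesTrivial.{u, w} {V : Type u} [DecidableEq V] {d N : ℕ} (hd : 0 < d)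
    {f g : Config V d N} (hs : UniteStep f g)
    (hreach : ∀ i i', Touch f i i' → (dualGraph f).Reachable i i')
    (hf : CocyclesTrivial.{u, w} f) : CocyclesTrivial.{u, w} g := by
  obtain ⟨R, S, hR, hS, hdisj, hsep, φ, hφ, hinj, hRS, hg⟩ := hs
  obtain ⟨i₀, hi₀c, hi₀⟩ := hR.exists_subset_facet
  obtain ⟨i₁, hi₁c, hi₁⟩ := hS.exists_subset_facet
  obtain ⟨w, hw⟩ := Finset.card_pos.mp (hd.trans_eq hR.1.symm)
  have hwS : φ w ∈ S := hRS ▸ Finset.mem_image_of_mem φ hw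
  have hfix : ∀ v ∈ S, φ v = v := fun v hv => hφ v (Finset.disjoint_right.mp hdisj hv)
  refine hf.of_map φ hg fun G _ c h hh => ?_
  classical
  let A : V → Prop := fun v => ∃ k j, (dualGraph f).Reachable i₀ k ∧ f k j = v
  have hA : ∀ i j, A (f i j) ↔ (dualGraph f).Reachable i₀ i := fun i j =>
    ⟨fun ⟨k, l, hk, e⟩ => hk.trans (hreach k i ⟨l, j, e⟩), fun hi => ⟨i, j, hi, rfl⟩⟩
  have hAS : ∀ v ∈ S, ¬ A v := fun v hv hv' => by
    obtain ⟨j, rfl⟩ := mem_facet.mp (hi₁ hv)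
    exact hsep i₀ hi₀c i₁ hi₁c ((hA i₁ j).mp hv')
  have hAR : ∀ v ∈ R, A v := fun v hv => by
    obtain ⟨j, rfl⟩ := mem_facet.mp (hi₀ hv)
    exact (hA i₀ j).mpr (SimpleGraph.Reachable.refl _)
  let h' : V → G := fun v => if A v then h (φ w) * (h w)⁻¹ * h v else h v
  have hh' : ∀ i j k, c (φ (f i j)) (φ (f i k)) = (h' (f i j))⁻¹ * h' (f i k) := by
    intro i j k
    rw [hh]
    by_cases hi : (dualGraph f).Reachable i₀ i
    · simp only [h', hA, hi, if_true]
      group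
    · simp only [h', hA, hi, if_false]
  have hw' : h' w = h' (φ w) := by
    simp [h', hAR w hw, hAS _ hwS]
  have key : ∀ u ∈ R, ∀ v ∈ S, φ u = φ v → h' u = h' v := fun u hu v hv huv => by
    have h₀ := coboundary_of_mem_facet hh' (hi₀ hu) (hi₀ hw)
    have h₁ := coboundary_of_mem_facet hh' (hi₁ hv) (hi₁ hwS)
    rw [hfix _ hwS, ← huv, h₀, hw'] at h₁
    exact inv_injective (mul_right_cancel h₁)
  refine ⟨h', hh', fun i j i' j' e => ?_⟩
  rcases eq_or_mem_of_map_eq hφ hinj hRS e with e' | ⟨hu, hv⟩ | ⟨hv, hu⟩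
  · rw [e']
  · exact key _ hu _ hv e
  · exact (key _ hv _ hu e.symm).symm

theorem uniteSteps_reachable_and_cocyclesTrivial.{w} {d N : ℕ} (hd : 0 < d)
    {t : Config (Fin N × Fin (d + 1)) d N} (hs : Relation.ReflTransGen UniteStep (std d N) t)
    (hp : Proper t) :
    (∀ i i', Touch t i i' → (dualGraph t).Reachable i i') ∧ CocyclesTrivial.{0, w} t := by
  induction hs with
  | refl =>
    refine ⟨fun i i' ⟨j, j', h⟩ => ?_, std_cocyclesTrivial d N⟩
    rw [show i = i' from congrArg Prod.fst h]
  | tail _ hs ih =>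
    obtain ⟨h₁, h₂⟩ := ih (by
      obtain ⟨-, -, -, -, -, -, φ, -, -, -, hg⟩ := hs
      exact hp.of_map hg)
    exact ⟨fun _ _ => hs.reachable_of_touch hp h₁, hs.cocyclesTrivial hd h₁ h₂⟩

theorem touch_of_adj {f : Config V d N} (hd : 0 < d) {i i' : Fin N}
    (h : (dualGraph f).Adj i i') : Touch f i i' := by
  obtain ⟨R, hR, h₁, h₂⟩ := dualGraph_adj h
  obtain ⟨v, hv⟩ := Finset.card_pos.mp (hd.trans_eq hR.symm)
  obtain ⟨j, hj⟩ := mem_facet.mp (h₁ hv)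
  obtain ⟨j', hj'⟩ := mem_facet.mp (h₂ hv)
  exact ⟨j, j', hj.trans hj'.symm⟩

theorem IsMogami.connected_and_cocyclesTrivial.{u, w} {V : Type u} {d N : ℕ} (hd : 0 < d)
    {f : Config V d N} (hp : Proper f) (hm : IsMogami f) :
    Nonempty (Fin N) ∧ (∀ i i', Relation.ReflTransGen (Touch f) i i') ∧
      CocyclesTrivial.{u, w} f := by
  obtain ⟨t, g, ⟨ht, hconn⟩, hsteps, hr⟩ := hm
  have hpg : Proper g := by
    obtain ⟨e, -, he⟩ := id hr
    exact hp.of_map he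
  have hpt := Proper.of_mogamiSteps hsteps hpg
  have htriv := (uniteSteps_reachable_and_cocyclesTrivial.{w} hd ht hpt).2
  have hg : CocyclesTrivial.{0, w} g ∧ ∀ i i', Relation.ReflTransGen (Touch g) i i' := by
    clear hr hpg
    induction hsteps with
    | refl =>
      refine ⟨htriv, fun i i' => ?_⟩
      have h := hconn.preconnected i i'
      rw [SimpleGraph.reachable_iff_reflTransGen] at h
      exact Relation.ReflTransGen.mono (fun _ _ => touch_of_adj hd) _ _ h
    | tail _ hs ih =>
      refine ⟨hs.cocyclesTrivial ih.1, fun i i' => ?_⟩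
      obtain ⟨-, -, -, -, -, -, φ, -, -, -, hφ⟩ := hs
      exact Relation.ReflTransGen.mono (fun _ _ => Touch.map hφ) _ _ (ih.2 i i')
  refine ⟨hconn.nonempty, fun _ _ => ?_, hr.cocyclesTrivial hg.1⟩
  obtain ⟨e, -, he⟩ := hr
  exact Relation.ReflTransGen.mono (fun _ _ => Touch.map he) _ _ (hg.2 _ _)

end

/-! ### Paths and the fundamental groupoid -/

open CategoryTheory

/-- The class of a path, as a morphism of the fundamental groupoid. -/
abbrev pathClass {X : Type*} [TopologicalSpace X] {x y : X} (γ : Path x y) :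
    FundamentalGroupoid.mk x ⟶ FundamentalGroupoid.mk y :=
  Path.Homotopic.Quotient.mk γ

theorem pathClass_trans {X : Type*} [TopologicalSpace X] {x y z : X} (γ : Path x y)
    (γ' : Path y z) : pathClass γ ≫ pathClass γ' = pathClass (γ.trans γ') := rfl

theorem pathClass_eq {X : Type*} [TopologicalSpace X] {x y : X} {γ γ' : Path x y}
    (h : γ.Homotopic γ') : pathClass γ = pathClass γ' :=
  Path.Homotopic.Quotient.eq.mpr h

/-- A choice of morphisms from a base point that is compatible with all sufficiently small paths
is compatible with all paths. -/
theorem comp_pathClass_of_locally {X : Type*} [TopologicalSpace X] {x₀ : X}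
    (H : ∀ x : X, FundamentalGroupoid.mk x₀ ⟶ FundamentalGroupoid.mk x)
    (hH : ∀ z : X, ∃ U : Set X, IsOpen U ∧ z ∈ U ∧ ∀ (x y : X) (γ : Path x y),
      (∀ t, γ t ∈ U) → H x ≫ pathClass γ = H y)
    {x y : X} (γ : Path x y) : H x ≫ pathClass γ = H y := by
  choose U hUo hU hHU using hH
  obtain ⟨t, ht₀, hmono, ⟨n, hn⟩, hsub⟩ :=
    exists_monotone_Icc_subset_open_cover_unitInterval
      (c := fun z => γ ⁻¹' U z) (fun z => (hUo z).preimage γ.continuous)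
      (fun s _ => Set.mem_iUnion.mpr ⟨γ s, hU _⟩)
  have step : ∀ m, H (γ 0) ≫ pathClass (γ.subpath 0 (t m)) = H (γ (t m)) := by
    intro m
    induction m with
    | zero =>
      rw [ht₀, Path.subpath_self]
      exact Category.comp_id _
    | succ m ih =>
      obtain ⟨z, hz⟩ := hsub m
      have hsmall := hHU z _ _ (γ.subpath (t m) (t (m + 1))) fun s => by
        have hs : γ.subpath (t m) (t (m + 1)) s ∈ Set.range (γ.subpath (t m) (t (m + 1))) :=
          ⟨s, rfl⟩
        rw [Path.range_subpath_of_le _ _ _ (hmono m.le_succ)] at hs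
        obtain ⟨r, hr, hrs⟩ := hs
        exact hrs ▸ hz hr
      rw [← hsmall, ← ih, Category.assoc, pathClass_trans,
        pathClass_eq ⟨Path.Homotopy.subpathTransSubpath γ 0 (t m) (t (m + 1))⟩]
  have hcast : ∀ {a b a' b' : X} (ha : a' = a) (hb : b' = b) (γ : Path a b),
      H a' ≫ pathClass (γ.cast ha hb) = H b' → H a ≫ pathClass γ = H b := by
    rintro a b _ _ rfl rfl γ h
    exact h
  refine hcast γ.source γ.target γ ?_
  rw [← Path.subpath_zero_one]
  have := step n
  rwa [hn n le_rfl] at this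

theorem simplyConnectedSpace_of_locally {X : Type*} [TopologicalSpace X] [PathConnectedSpace X]
    {x₀ : X} (H : ∀ x : X, FundamentalGroupoid.mk x₀ ⟶ FundamentalGroupoid.mk x)
    (hH : ∀ z : X, ∃ U : Set X, IsOpen U ∧ z ∈ U ∧ ∀ (x y : X) (γ : Path x y),
      (∀ t, γ t ∈ U) → H x ≫ pathClass γ = H y) : SimplyConnectedSpace X := by
  refine simply_connected_iff_paths_homotopic'.mpr ⟨inferInstance, fun {x y} γ γ' => ?_⟩
  have h := (comp_pathClass_of_locally H hH γ).trans (comp_pathClass_of_locally H hH γ').symm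
  exact Path.Homotopic.Quotient.eq.mp ((cancel_epi (H x)).mp h)

/-- Two paths with the same endpoints inside a star-convex part of `X` are homotopic in `X`. -/
theorem homotopic_of_starConvex {E : Type*} [AddCommGroup E] [Module ℝ E] [TopologicalSpace E]
    [ContinuousAdd E] [ContinuousSMul ℝ E] {X A : Set E} (hAX : A ⊆ X) {v : E}
    (hA : StarConvex ℝ v A) {x y : X} (γ γ' : Path x y) (hγ : ∀ t, (γ t : E) ∈ A)
    (hγ' : ∀ t, (γ' t : E) ∈ A) : γ.Homotopic γ' := by
  have hx : (x : E) ∈ A := by simpa using hγ 0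
  have hy : (y : E) ∈ A := by simpa using hγ 1
  have := hA.contractibleSpace ⟨_, hx⟩
  let lift (δ : Path x y) (hδ : ∀ t, (δ t : E) ∈ A) : Path (⟨x, hx⟩ : A) ⟨y, hy⟩ :=
    { toFun := fun t => ⟨δ t, hδ t⟩
      continuous_toFun := by fun_prop
      source' := by simp
      target' := by simp }
  exact (SimplyConnectedSpace.paths_homotopic (lift γ hγ) (lift γ' hγ')).map
    ⟨Set.inclusion hAX, continuous_inclusion hAX⟩

/-- The straight path between two points of `X`. -/
def segmentPath {E : Type*} [AddCommGroup E] [Module ℝ E] [TopologicalSpace E]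
    [ContinuousAdd E] [ContinuousSMul ℝ E] {X : Set E} (x y : X)
    (h : segment ℝ (x : E) y ⊆ X) : Path x y where
  toFun t := ⟨(1 - (t : ℝ)) • (x : E) + (t : ℝ) • (y : E),
    h ⟨1 - t, t, sub_nonneg.mpr t.2.2, t.2.1, sub_add_cancel _ _, rfl⟩⟩
  continuous_toFun := by fun_prop
  source' := by simp
  target' := by simp

theorem segmentPath_mem {E : Type*} [AddCommGroup E] [Module ℝ E] [TopologicalSpace E]
    [ContinuousAdd E] [ContinuousSMul ℝ E] {X A : Set E} {x y : X}
    (h : segment ℝ (x : E) y ⊆ X) (hA : segment ℝ (x : E) y ⊆ A) (t : unitInterval) :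
    (segmentPath x y h t : E) ∈ A :=
  hA ⟨1 - t, t, sub_nonneg.mpr t.2.2, t.2.1, sub_add_cancel _ _, rfl⟩

theorem path_trans_mem {X : Type*} [TopologicalSpace X] {A : Set X} {x y z : X} {γ : Path x y}
    {γ' : Path y z} (h : ∀ t, γ t ∈ A) (h' : ∀ t, γ' t ∈ A) (t : unitInterval) :
    γ.trans γ' t ∈ A := by
  rw [Path.trans_apply]
  split_ifs
  exacts [h _, h' _]

open Classical in
/-- The class of the straight path, or a junk value if the segment leaves `X`. -/
noncomputable def segmentClass {E : Type*} [AddCommGroup E] [Module ℝ E] [TopologicalSpace E]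
    [ContinuousAdd E] [ContinuousSMul ℝ E] {X : Set E} [PathConnectedSpace X] (x y : X) :
    FundamentalGroupoid.mk x ⟶ FundamentalGroupoid.mk y :=
  if h : segment ℝ (x : E) y ⊆ X then pathClass (segmentPath x y h)
  else pathClass (PathConnectedSpace.somePath x y)

theorem segmentClass_comp {E : Type*} [AddCommGroup E] [Module ℝ E] [TopologicalSpace E]
    [ContinuousAdd E] [ContinuousSMul ℝ E] {X A : Set E} [PathConnectedSpace X] (hAX : A ⊆ X)
    {v : E} (hA : StarConvex ℝ v A) {x y z : X} (γ : Path y z) (hγ : ∀ t, (γ t : E) ∈ A)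
    (hxy : segment ℝ (x : E) y ⊆ A) (hxz : segment ℝ (x : E) z ⊆ A) :
    segmentClass x y ≫ pathClass γ = segmentClass x z := by
  rw [segmentClass, segmentClass, dif_pos (hxy.trans hAX), dif_pos (hxz.trans hAX),
    pathClass_trans]
  exact pathClass_eq (homotopic_of_starConvex hAX hA _ _
    (path_trans_mem (A := Subtype.val ⁻¹' A) (segmentPath_mem _ hxy) hγ)
    (segmentPath_mem _ hxz))

theorem segmentClass_comp_segmentClass {E : Type*} [AddCommGroup E] [Module ℝ E]
    [TopologicalSpace E] [ContinuousAdd E] [ContinuousSMul ℝ E] {X A : Set E}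
    [PathConnectedSpace X] (hAX : A ⊆ X) (hA : Convex ℝ A) {x y z : X} (hx : (x : E) ∈ A)
    (hy : (y : E) ∈ A) (hz : (z : E) ∈ A) :
    segmentClass x y ≫ segmentClass y z = segmentClass x z := by
  have hyz := hA.segment_subset hy hz
  rw [show segmentClass y z = pathClass (segmentPath y z (hyz.trans hAX)) from
    dif_pos (hyz.trans hAX)]
  exact segmentClass_comp hAX (hA.starConvex hx) _ (segmentPath_mem _ hyz)
    (hA.segment_subset hx hy) (hA.segment_subset hx hz)

/-! ### The realization -/

section

variable {V : Type*} [DecidableEq V] [Fintype V] {d N : ℕ}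

/-- The closed simplex of the realization spanned by the `i`-th facet. -/
def simplex (f : Config V d N) (i : Fin N) : Set (V → ℝ) :=
  {x | (∀ v, 0 ≤ x v) ∧ (∑ v, x v) = 1 ∧ ∀ v, x v ≠ 0 → v ∈ facet f i}

theorem mem_realization {f : Config V d N} {x : V → ℝ} :
    x ∈ realization f ↔ ∃ i, x ∈ simplex f i :=
  ⟨fun ⟨h₀, h₁, i, hi⟩ => ⟨i, h₀, h₁, hi⟩, fun ⟨i, h₀, h₁, hi⟩ => ⟨h₀, h₁, i, hi⟩⟩

theorem simplex_subset (f : Config V d N) (i : Fin N) : simplex f i ⊆ realization f :=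
  fun _ hx => mem_realization.mpr ⟨i, hx⟩

theorem convex_simplex (f : Config V d N) (i : Fin N) : Convex ℝ (simplex f i) := by
  rintro x ⟨hx₀, hx₁, hx⟩ y ⟨hy₀, hy₁, hy⟩ a b ha hb hab
  refine ⟨fun v => ?_, ?_, fun v hv => ?_⟩
  · exact add_nonneg (mul_nonneg ha (hx₀ v)) (mul_nonneg hb (hy₀ v))
  · simp [Finset.sum_add_distrib, ← Finset.mul_sum, hx₁, hy₁, hab]
  · by_contra hvi
    have h₁ : x v = 0 := by_contra fun h => hvi (hx v h)
    have h₂ : y v = 0 := by_contra fun h => hvi (hy v h)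
    simp [h₁, h₂] at hv

theorem single_mem_simplex {f : Config V d N} {i : Fin N} {v : V} (hv : v ∈ facet f i) :
    (Pi.single v 1 : V → ℝ) ∈ simplex f i := by
  refine ⟨fun u => ?_, by simp, fun u hu => ?_⟩
  · rw [Pi.single_apply]
    split_ifs <;> simp
  · by_contra hui
    refine hu (Pi.single_eq_of_ne ?_ _)
    rintro rfl
    exact hui hv

theorem pathConnectedSpace_realization {f : Config V d N} (hN : Nonempty (Fin N))
    (hconn : ∀ i i', Relation.ReflTransGen (Touch f) i i') :
    PathConnectedSpace (realization f) := by
  have hvert : ∀ i j, (Pi.single (f i j) 1 : V → ℝ) ∈ simplex f i := fun i j =>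
    single_mem_simplex (mem_facet.mpr ⟨j, rfl⟩)
  have hjoin : ∀ i, ∀ x ∈ simplex f i, ∀ y ∈ simplex f i, JoinedIn (realization f) x y :=
    fun i x hx y hy => JoinedIn.of_segment_subset
      (((convex_simplex f i).segment_subset hx hy).trans (simplex_subset f i))
  rw [← isPathConnected_iff_pathConnectedSpace, isPathConnected_iff]
  refine ⟨⟨_, simplex_subset f _ (hvert hN.some 0)⟩, fun x hx y hy => ?_⟩
  obtain ⟨i, hi⟩ := mem_realization.mp hx
  obtain ⟨i', hi'⟩ := mem_realization.mp hy
  have h := hconn i i'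
  clear hy
  induction h generalizing y with
  | refl => exact hjoin i x hi y hi'
  | @tail k l _ hkl ih =>
    obtain ⟨j, j', e⟩ := hkl
    exact (ih _ (hvert k j)).trans (hjoin l _ (e ▸ hvert l j') y hi')

/-- The part of the realization where the coordinate of the vertex `v` is positive. -/
def openStar (f : Config V d N) (v : V) : Set (V → ℝ) :=
  {x | x ∈ realization f ∧ 0 < x v}

theorem starConvex_openStar (f : Config V d N) (v : V) :
    StarConvex ℝ (Pi.single v 1) (openStar f v) := by
  rintro x ⟨hx, hxv⟩ a b ha hb hab
  obtain ⟨i, hi⟩ := mem_realization.mp hx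
  refine ⟨simplex_subset f i (convex_simplex f i
    (single_mem_simplex (hi.2.2 v hxv.ne')) hi ha hb hab), ?_⟩
  simp only [Pi.add_apply, Pi.smul_apply, Pi.single_eq_same, smul_eq_mul, mul_one]
  rcases ha.eq_or_lt with rfl | ha'
  · rw [zero_add] at hab
    simpa [hab] using hxv
  · exact add_pos_of_pos_of_nonneg ha' (mul_nonneg hb hxv.le)

theorem exists_pos_of_mem_realization {f : Config V d N} {x : V → ℝ}
    (hx : x ∈ realization f) : ∃ v, 0 < x v := by
  by_contra! h
  have := Finset.sum_nonpos (s := Finset.univ) fun v _ => h v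
  rw [hx.2.1] at this
  exact absurd this (by norm_num)

end

theorem simplyConnectedSpace_realization.{u} {V : Type u} [DecidableEq V] [Fintype V] {d N : ℕ}
    {f : Config V d N} (hN : Nonempty (Fin N))
    (hconn : ∀ i i', Relation.ReflTransGen (Touch f) i i') (hf : CocyclesTrivial.{u, u} f) :
    SimplyConnectedSpace (realization f) := by
  classical
  have := pathConnectedSpace_realization hN hconn
  have hsingle : ∀ i, ∀ v ∈ facet f i, (Pi.single v 1 : V → ℝ) ∈ simplex f i :=
    fun i v hv => single_mem_simplex hv
  let x₀ : realization f :=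
    ⟨_, simplex_subset f _ (hsingle hN.some _ (mem_facet.mpr ⟨0, rfl⟩))⟩
  let vert (v : V) : realization f :=
    if h : (Pi.single v 1 : V → ℝ) ∈ realization f then ⟨_, h⟩ else x₀
  have hvert : ∀ i, ∀ v ∈ facet f i, (vert v : V → ℝ) = Pi.single v 1 := fun i v hv => by
    simp only [vert, dif_pos (simplex_subset f i (hsingle i v hv))]
  have hvert_mem : ∀ i, ∀ v ∈ facet f i, (vert v : V → ℝ) ∈ simplex f i := fun i v hv => by
    rw [hvert i v hv]
    exact hsingle i v hv
  have hseg : ∀ i, ∀ u ∈ facet f i, ∀ v ∈ facet f i, ∀ x : realization f,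
      (x : V → ℝ) ∈ simplex f i →
      segmentClass (vert u) (vert v) ≫ segmentClass (vert v) x = segmentClass (vert u) x :=
    fun i u hu v hv x hx => segmentClass_comp_segmentClass (simplex_subset f i)
      (convex_simplex f i) (hvert_mem i u hu) (hvert_mem i v hv) hx
  let P (v : V) : FundamentalGroupoid.mk x₀ ⟶ FundamentalGroupoid.mk (vert v) :=
    pathClass (PathConnectedSpace.somePath x₀ (vert v))
  obtain ⟨h, hh⟩ := hf (End (FundamentalGroupoid.mk x₀))ᵐᵒᵖ
    (fun u v => MulOpposite.op (End.of (P u ≫ segmentClass (vert u) (vert v) ≫ inv (P v))))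
    (fun i j k l => by
      rw [← MulOpposite.op_mul, End.mul_def]
      congr 1
      simp only [Category.assoc, IsIso.inv_hom_id_assoc, End.of]
      rw [← hseg i (f i j) (mem_facet.mpr ⟨j, rfl⟩) (f i k) (mem_facet.mpr ⟨k, rfl⟩) _
        (hvert_mem i _ (mem_facet.mpr ⟨l, rfl⟩)), Category.assoc])
  let Q (v : V) : FundamentalGroupoid.mk x₀ ⟶ FundamentalGroupoid.mk (vert v) :=
    (h v).unop.asHom ≫ P v
  have hQ : ∀ i, ∀ u ∈ facet f i, ∀ v ∈ facet f i,
      Q u ≫ segmentClass (vert u) (vert v) = Q v := by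
    intro i u hu v hv
    obtain ⟨j, rfl⟩ := mem_facet.mp hu
    obtain ⟨k, rfl⟩ := mem_facet.mp hv
    have e := congrArg MulOpposite.unop (eq_inv_mul_iff_mul_eq.mp (hh i j k))
    rw [MulOpposite.unop_mul, End.mul_def] at e
    have e' := congrArg (fun m => m ≫ P (f i k)) e
    simpa [Q, End.of] using e'
  have hpos : ∀ x : realization f, ∃ v, 0 < (x : V → ℝ) v := fun x =>
    exists_pos_of_mem_realization x.2
  choose c hc using hpos
  let H (x : realization f) : FundamentalGroupoid.mk x₀ ⟶ FundamentalGroupoid.mk x :=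
    Q (c x) ≫ segmentClass (vert (c x)) x
  have hH : ∀ (x : realization f) (v : V), 0 < (x : V → ℝ) v →
      H x = Q v ≫ segmentClass (vert v) x := by
    intro x v hv
    obtain ⟨i, hi⟩ := mem_realization.mp x.2
    have hui := hi.2.2 _ (hc x).ne'
    have hvi := hi.2.2 _ hv.ne'
    rw [← hQ i _ hui _ hvi, Category.assoc, hseg i _ hui _ hvi x hi]
  refine simplyConnectedSpace_of_locally H fun z =>
    ⟨{x | 0 < (x : V → ℝ) (c z)}, ?_, hc z, fun x y γ hγ => ?_⟩
  · exact isOpen_lt continuous_const ((continuous_apply (c z)).comp continuous_subtype_val)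
  · have hx : 0 < (x : V → ℝ) (c z) := by simpa using hγ 0
    have hy : 0 < (y : V → ℝ) (c z) := by simpa using hγ 1
    obtain ⟨i, hi⟩ := mem_realization.mp x.2
    have hv := hvert i _ (hi.2.2 _ hx.ne')
    have hstar := starConvex_openStar f (c z)
    rw [hH x _ hx, hH y _ hy, Category.assoc]
    congr 1
    refine segmentClass_comp (A := openStar f (c z)) (fun _ h => h.1) hstar γ
      (fun t => ⟨(γ t).2, hγ t⟩) ?_ ?_ <;> rw [hv]
    · exact starConvex_iff_segment_subset.mp hstar ⟨x.2, hx⟩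
    · exact starConvex_iff_segment_subset.mp hstar ⟨y.2, hy⟩

/-- every Mogami `d`-pseudomanifold is simply connected. -/
theorem stmt7 {V : Type*} [DecidableEq V] [Fintype V] {d N : ℕ} (hd : 2 ≤ d)
    (f : Config V d N) (hp : IsPseudo f) (hm : IsMogami f) :
    SimplyConnectedSpace (realization f) := by
  obtain ⟨hN, hconn, htriv⟩ := hm.connected_and_cocyclesTrivial (by omega) hp.1
  exact simplyConnectedSpace_realization hN hconn htriv

end MogamiPaper
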